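/- For all n ≥ 1: (C(3n+1, n−2) − 3·C(3n, n−3)) / ((1/(2n+1))·C(3n, n)) = 7(n−1)n/(2(2n+3)(n+1)). -/

import Mathlib

/-- Binomial coefficient `C(a, b)` for integers, zero when `b < 0` or `b > a`. -/
def intChoose (a b : ℤ) : ℤ :=
  if 0 ≤ b then (a.toNat.choose b.toNat : ℤ) else 0

theorem stmt_18 (n : ℕ) (hn : 1 ≤ n) :
    ((intChoose (3 * n + 1) (n - 2) - 3 * intChoose (3 * n) (n - 3) : ℤ) : ℚ) /
        ((1 / (2 * n + 1)) * Nat.choose (3 * n) n) =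
      7 * (n - 1) * n / (2 * (2 * n + 3) * (n + 1)) := by
  obtain rfl | rfl | ⟨m, rfl⟩ : n = 1 ∨ n = 2 ∨ ∃ m, n = m + 3 := by
    rcases n with _ | _ | _ | m
    · omega
    · simp
    · simp
    · exact Or.inr (Or.inr ⟨m, rfl⟩)
  · norm_num [intChoose]
  · norm_num [intChoose, Nat.choose]
  have e1 : intChoose (3 * ((m + 3 : ℕ) : ℤ) + 1) (((m + 3 : ℕ) : ℤ) - 2)
      = (((3 * m + 10).choose (m + 1) : ℕ) : ℤ) := by
    have h1 : (3 * ((m + 3 : ℕ) : ℤ) + 1).toNat = 3 * m + 10 := by omega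
    have h2 : (((m + 3 : ℕ) : ℤ) - 2).toNat = m + 1 := by omega
    rw [intChoose, if_pos (by omega), h1, h2]
  have e2 : intChoose (3 * ((m + 3 : ℕ) : ℤ)) (((m + 3 : ℕ) : ℤ) - 3)
      = (((3 * m + 9).choose m : ℕ) : ℤ) := by
    have h1 : (3 * ((m + 3 : ℕ) : ℤ)).toNat = 3 * m + 9 := by omega
    have h2 : (((m + 3 : ℕ) : ℤ) - 3).toNat = m := by omega
    rw [intChoose, if_pos (by omega), h1, h2]
  have k1 := Nat.choose_succ_right_eq (3 * m + 9) m
  have k2 := Nat.choose_succ_right_eq (3 * m + 9) (m + 1)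
  have k3 := Nat.choose_succ_right_eq (3 * m + 9) (m + 2)
  rw [show 3 * m + 9 - m = 2 * m + 9 by omega] at k1
  rw [show 3 * m + 9 - (m + 1) = 2 * m + 8 by omega] at k2
  rw [show 3 * m + 9 - (m + 2) = 2 * m + 7 by omega] at k3
  have pos : 0 < (3 * m + 9).choose m := Nat.choose_pos (by omega)
  rw [e1, e2, show 3 * (m + 3) = 3 * m + 9 by ring,
    show 3 * m + 10 = (3 * m + 9) + 1 by ring, Nat.choose_succ_succ']
  simp only [add_assoc, Nat.reduceAdd] at k1 k2 k3
  generalize (3 * m + 9).choose m = a at *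
  generalize (3 * m + 9).choose (m + 1) = b at *
  generalize (3 * m + 9).choose (m + 2) = c at *
  generalize (3 * m + 9).choose (m + 3) = d at *
  have q1 : (b : ℚ) * (m + 1) = a * (2 * m + 9) := by exact_mod_cast k1
  have q2 : (c : ℚ) * (m + 2) = b * (2 * m + 8) := by exact_mod_cast k2
  have q3 : (d : ℚ) * (m + 3) = c * (2 * m + 7) := by exact_mod_cast k3
  have pq : (a : ℚ) ≠ 0 := by exact_mod_cast pos.ne'
  have hb : (b : ℚ) = a * (2 * m + 9) / (m + 1) := by
    rw [← q1]; field_simp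
  have hc : (c : ℚ) = b * (2 * m + 8) / (m + 2) := by
    rw [← q2]; field_simp
  have hd : (d : ℚ) = c * (2 * m + 7) / (m + 3) := by
    rw [← q3]; field_simp
  push_cast
  rw [hd, hc, hb]
  have t1 : (2 * (m : ℚ) + 9) ≠ 0 := by positivity
  have t2 : (2 * (m : ℚ) + 8) ≠ 0 := by positivity
  have t3 : (2 * (m : ℚ) + 7) ≠ 0 := by positivity
  have t4 : (2 * ((m : ℚ) + 3) + 3) ≠ 0 := by positivity
  have t5 : (2 * ((m : ℚ) + 3) + 1) ≠ 0 := by positivity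
  have t6 : ((m : ℚ) + 3 + 1) ≠ 0 := by positivity
  field_simp
  ring
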